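/- arXiv:1705.01862 — 2 statements merged into one kernel-verified Lean document; each statement's English description precedes it below -/
import Mathlib

section
/- Consider the discrete-time linear system x_{j+1} = A x_j + B u_j with A ∈ ℝ^{n×n}, B ∈ ℝ^{n×m}, symmetric positive semidefinite Q, S ∈ ℝ^{n×n}, symmetric positive definite R ∈ ℝ^{m×m}, horizon N ∈ ℕ, and finite-horizon cost J(x_0, u) = Σ_{j=0}^{N−1}(x_jᵀQx_j + u_jᵀRu_j) + x_NᵀSx_N. Let P_0 be obtained from the backward Riccati recursion P_N = S, P_{k−1} = AᵀP_kA + Q − AᵀP_kB(R + BᵀP_kB)⁻¹BᵀP_kA. Then for every x_0 ∈ ℝⁿ and every input sequence (u_0, ..., u_{N−1}), one has J(x_0, u) ≥ x_0ᵀP_0x_0. -/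
open Matrix

section RiccatiStep

variable {n m : Type*} [Fintype n] [Fintype m]

theorem dotProduct_mulVec_eq_transpose (M : Matrix n m ℝ) (v : n → ℝ) (w : m → ℝ) :
    v ⬝ᵥ M *ᵥ w = (Mᵀ *ᵥ v) ⬝ᵥ w := by
  rw [dotProduct_mulVec, mulVec_transpose]

theorem Matrix.PosSemidef.dotProduct_mulVec_self_nonneg {M : Matrix n n ℝ} (hM : M.PosSemidef)
    (v : n → ℝ) : 0 ≤ v ⬝ᵥ M *ᵥ v := by
  simpa using hM.dotProduct_mulVec_nonneg v

theorem posDef_add_transpose_mul_mul {R : Matrix m m ℝ} {P : Matrix n n ℝ}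
    (hR : R.PosDef) (hP : P.PosSemidef) (B : Matrix n m ℝ) :
    (R + Bᵀ * P * B).PosDef := by
  simpa using hR.add_posSemidef (hP.conjTranspose_mul_mul_same B)

variable [DecidableEq m]

/-- One step of the backward Riccati recursion, for system matrices `A`, `B`, stage weights `Q`, `R`
and terminal weight `P`. -/
noncomputable def riccatiStep (A : Matrix n n ℝ) (B : Matrix n m ℝ) (Q : Matrix n n ℝ)
    (R : Matrix m m ℝ) (P : Matrix n n ℝ) : Matrix n n ℝ :=
  Aᵀ * P * A + Q - Aᵀ * P * B * (R + Bᵀ * P * B)⁻¹ * Bᵀ * P * A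

variable {A : Matrix n n ℝ} {B : Matrix n m ℝ} {Q : Matrix n n ℝ} {R : Matrix m m ℝ}
  {P : Matrix n n ℝ}

/-- Completion of the square for the one-step cost of a linear quadratic regulator. -/
theorem riccatiStep_complete_square (hR : R.PosDef) (hP : P.PosSemidef) (x : n → ℝ) (u : m → ℝ) :
    x ⬝ᵥ Q *ᵥ x + u ⬝ᵥ R *ᵥ u + (A *ᵥ x + B *ᵥ u) ⬝ᵥ P *ᵥ (A *ᵥ x + B *ᵥ u) =
      x ⬝ᵥ riccatiStep A B Q R P *ᵥ x +
        (u + (R + Bᵀ * P * B)⁻¹ *ᵥ Bᵀ *ᵥ P *ᵥ A *ᵥ x) ⬝ᵥ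
          (R + Bᵀ * P * B) *ᵥ (u + (R + Bᵀ * P * B)⁻¹ *ᵥ Bᵀ *ᵥ P *ᵥ A *ᵥ x) := by
  have hW := posDef_add_transpose_mul_mul hR hP B
  have hPt : Pᵀ = P := by simpa using hP.isHermitian.eq
  have hWt : (R + Bᵀ * P * B)ᵀ = R + Bᵀ * P * B := by simpa using hW.isHermitian.eq
  set W := R + Bᵀ * P * B with hWdef
  set g := Bᵀ *ᵥ P *ᵥ A *ᵥ x with hg
  set k := W⁻¹ *ᵥ g with hk
  have hWk : W *ᵥ k = g := by
    rw [hk, mulVec_mulVec, mul_nonsing_inv _ ((isUnit_iff_isUnit_det _).1 hW.isUnit), one_mulVec]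
  have hkWu : k ⬝ᵥ W *ᵥ u = u ⬝ᵥ g := by
    rw [dotProduct_mulVec_eq_transpose, hWt, hWk, dotProduct_comm]
  have huWu : u ⬝ᵥ W *ᵥ u = u ⬝ᵥ R *ᵥ u + (B *ᵥ u) ⬝ᵥ P *ᵥ B *ᵥ u := by
    rw [hWdef, add_mulVec, dotProduct_add, ← mulVec_mulVec, ← mulVec_mulVec,
      dotProduct_mulVec_eq_transpose Bᵀ, transpose_transpose]
  have hug : u ⬝ᵥ g = (B *ᵥ u) ⬝ᵥ P *ᵥ A *ᵥ x := by
    rw [hg, dotProduct_mulVec_eq_transpose Bᵀ, transpose_transpose]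
  have hcross : (A *ᵥ x) ⬝ᵥ P *ᵥ B *ᵥ u = (B *ᵥ u) ⬝ᵥ P *ᵥ A *ᵥ x := by
    rw [dotProduct_mulVec_eq_transpose, hPt, dotProduct_comm]
  have hstep : x ⬝ᵥ riccatiStep A B Q R P *ᵥ x =
      (A *ᵥ x) ⬝ᵥ P *ᵥ A *ᵥ x + x ⬝ᵥ Q *ᵥ x - k ⬝ᵥ g := by
    have hkg : x ⬝ᵥ Aᵀ *ᵥ P *ᵥ B *ᵥ k = k ⬝ᵥ g := by
      rw [dotProduct_mulVec_eq_transpose Aᵀ, dotProduct_mulVec_eq_transpose P,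
        dotProduct_mulVec_eq_transpose B, hPt, transpose_transpose, dotProduct_comm]
    rw [riccatiStep, ← hWdef, sub_mulVec, add_mulVec, dotProduct_sub, dotProduct_add]
    simp only [← mulVec_mulVec]
    rw [← hg, ← hk, hkg, dotProduct_mulVec_eq_transpose Aᵀ, transpose_transpose]
  rw [hstep]
  simp only [mulVec_add, dotProduct_add, add_dotProduct, hWk, hkWu, huWu, hcross, ← hug]
  ring

theorem riccatiStep_le_cost (hR : R.PosDef) (hP : P.PosSemidef) (x : n → ℝ) (u : m → ℝ) :
    x ⬝ᵥ riccatiStep A B Q R P *ᵥ x ≤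
      x ⬝ᵥ Q *ᵥ x + u ⬝ᵥ R *ᵥ u + (A *ᵥ x + B *ᵥ u) ⬝ᵥ P *ᵥ (A *ᵥ x + B *ᵥ u) := by
  rw [riccatiStep_complete_square hR hP, le_add_iff_nonneg_right]
  exact (posDef_add_transpose_mul_mul hR hP B).posSemidef.dotProduct_mulVec_self_nonneg _

theorem Matrix.PosSemidef.riccatiStep (hQ : Q.PosSemidef) (hR : R.PosDef) (hP : P.PosSemidef) :
    (riccatiStep A B Q R P).PosSemidef := by
  refine .of_dotProduct_mulVec_nonneg ?_ fun x ↦ ?_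
  · have hWi := (posDef_add_transpose_mul_mul hR hP B).inv.posSemidef
    have h := ((hP.conjTranspose_mul_mul_same A).add hQ).isHermitian.sub
      (hWi.conjTranspose_mul_mul_same (Bᵀ * P * A)).isHermitian
    have hPt : Pᵀ = P := by simpa using hP.isHermitian.eq
    simpa [_root_.riccatiStep, hPt, Matrix.mul_assoc] using h
  · have h := riccatiStep_complete_square (A := A) (B := B) (Q := Q) hR hP x
      (-((R + Bᵀ * P * B)⁻¹ *ᵥ Bᵀ *ᵥ P *ᵥ A *ᵥ x))
    rw [neg_add_cancel, zero_dotProduct, add_zero] at h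
    rw [star_trivial, ← h]
    exact add_nonneg (add_nonneg (hQ.dotProduct_mulVec_self_nonneg _)
      (hR.posSemidef.dotProduct_mulVec_self_nonneg _)) (hP.dotProduct_mulVec_self_nonneg _)

end RiccatiStep

/-- The finite-horizon LQR cost is bounded below by the Riccati quadratic form `x₀ᵀ P₀ x₀`. -/
theorem finite_horizon_cost_lower_bound {n m : ℕ}
    (A : Matrix (Fin n) (Fin n) ℝ) (B : Matrix (Fin n) (Fin m) ℝ)
    (Q S : Matrix (Fin n) (Fin n) ℝ) (R : Matrix (Fin m) (Fin m) ℝ)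
    (hQ : Q.PosSemidef) (hS : S.PosSemidef) (hR : R.PosDef)
    (N : ℕ) (P : ℕ → Matrix (Fin n) (Fin n) ℝ)
    (hPN : P N = S)
    (hrec : ∀ k, k < N →
      P k = Aᵀ * P (k + 1) * A + Q -
        Aᵀ * P (k + 1) * B * (R + Bᵀ * P (k + 1) * B)⁻¹ * Bᵀ * P (k + 1) * A)
    (x : ℕ → Fin n → ℝ) (u : ℕ → Fin m → ℝ)
    (hx : ∀ j, x (j + 1) = A *ᵥ x j + B *ᵥ u j) :
    (∑ j ∈ Finset.range N, (x j ⬝ᵥ (Q *ᵥ x j) + u j ⬝ᵥ (R *ᵥ u j))) +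
      x N ⬝ᵥ (S *ᵥ x N) ≥ x 0 ⬝ᵥ (P 0 *ᵥ x 0) := by
  have hrec' (k : ℕ) (hk : k < N) : P k = riccatiStep A B Q R (P (k + 1)) := hrec k hk
  have hP (k : ℕ) (hk : k ≤ N) : (P k).PosSemidef := by
    induction hk using Nat.decreasingInduction with
    | self => exact hPN ▸ hS
    | of_succ k hk ih => exact hrec' k hk ▸ hQ.riccatiStep hR ih
  have hcost (k : ℕ) (hk : k ≤ N) : x 0 ⬝ᵥ P 0 *ᵥ x 0 ≤
      (∑ j ∈ Finset.range k, (x j ⬝ᵥ Q *ᵥ x j + u j ⬝ᵥ R *ᵥ u j)) + x k ⬝ᵥ P k *ᵥ x k := by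
    induction k with
    | zero => simp
    | succ k ih =>
      have h := riccatiStep_le_cost (A := A) (B := B) (Q := Q) hR (hP (k + 1) hk) (x k) (u k)
      rw [← hrec' k hk, ← hx] at h
      rw [Finset.sum_range_succ]
      linarith [ih (Nat.le_of_succ_le hk)]
  exact hPN ▸ hcost N le_rfl
end

section
/- (Lemma 4 of the paper, stated with explicit hypotheses.) Consider the discrete-time linear system x_{j+1} = A x_j + B u_j with A ∈ ℝ^{n×n}, B ∈ ℝ^{n×m}, symmetric positive semidefinite Q, S ∈ ℝ^{n×n}, symmetric positive definite R ∈ ℝ^{m×m}, horizon N ≥ 1, and finite-horizon cost J(x_0, u) = Σ_{j=0}^{N−1}(x_jᵀQx_j + u_jᵀRu_j) + x_NᵀSx_N. Let K ∈ ℝ^{m×n} satisfy the terminal decrease condition that S − (A + BK)ᵀS(A + BK) − Q − KᵀRK is positive semidefinite, and let α_3 be the smallest eigenvalue of Q. Then for every initial state x_0 and inputs (u_0, ..., u_{N−1}) with states x_{j+1} = A x_j + B u_j, the shifted input sequence (u_1, ..., u_{N−1}, K x_N) applied from x_1 = A x_0 + B u_0 satisfies J(x_1, (u_1, ..., u_{N−1},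 K x_N)) ≤ J(x_0, u) − x_0ᵀQx_0 ≤ J(x_0, u) − α_3‖x_0‖², where ‖·‖ is the Euclidean norm. -/
open Matrix

/-- State trajectory of the discrete-time linear system `x_{j+1} = A x_j + B u_j`. -/
noncomputable def lqrTraj {n m : ℕ} (A : Matrix (Fin n) (Fin n) ℝ)
    (B : Matrix (Fin n) (Fin m) ℝ) (x0 : Fin n → ℝ) (u : ℕ → Fin m → ℝ) :
    ℕ → Fin n → ℝ
  | 0 => x0
  | j + 1 => A *ᵥ lqrTraj A B x0 u j + B *ᵥ u j

/-- Finite-horizon cost `J(x₀, u)` of an input sequence `u` from initial state `x₀`. -/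
noncomputable def lqrCost {n m : ℕ} (A : Matrix (Fin n) (Fin n) ℝ)
    (B : Matrix (Fin n) (Fin m) ℝ) (Q S : Matrix (Fin n) (Fin n) ℝ)
    (R : Matrix (Fin m) (Fin m) ℝ) (N : ℕ) (x0 : Fin n → ℝ) (u : ℕ → Fin m → ℝ) : ℝ :=
  (∑ j ∈ Finset.range N,
      (lqrTraj A B x0 u j ⬝ᵥ (Q *ᵥ lqrTraj A B x0 u j) + u j ⬝ᵥ (R *ᵥ u j))) +
    lqrTraj A B x0 u N ⬝ᵥ (S *ᵥ lqrTraj A B x0 u N)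

/-- The quadratic form of a Hermitian real matrix dominates any lower bound on the eigenvalues. -/
theorem Matrix.IsHermitian.mul_dotProduct_le {n : ℕ} {Q : Matrix (Fin n) (Fin n) ℝ}
    (hQ : Q.IsHermitian) {c : ℝ} (hc : ∀ i, c ≤ hQ.eigenvalues i) (x : Fin n → ℝ) :
    c * (x ⬝ᵥ x) ≤ x ⬝ᵥ (Q *ᵥ x) := by
  open scoped MatrixOrder in
  have hle : algebraMap ℝ (Matrix (Fin n) (Fin n) ℝ) c ≤ Q := by
    refine algebraMap_le_of_le_spectrum (fun y hy => ?_) hQ.isSelfAdjoint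
    rw [hQ.spectrum_real_eq_range_eigenvalues] at hy
    obtain ⟨i, rfl⟩ := hy
    exact hc i
  have h := (Matrix.le_iff.mp hle).dotProduct_mulVec_nonneg x
  rw [Algebra.algebraMap_eq_smul_one, sub_mulVec, smul_mulVec, one_mulVec, dotProduct_sub,
    dotProduct_smul, smul_eq_mul, star_trivial] at h
  linarith

/-- Evaluated at a state `x`, the terminal decrease condition bounds the cost of one more step
under the feedback `u = K x`. -/
theorem terminal_cost_decrease {n m : ℕ} {A : Matrix (Fin n) (Fin n) ℝ}
    {B : Matrix (Fin n) (Fin m) ℝ} {Q S : Matrix (Fin n) (Fin n) ℝ}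
    {R : Matrix (Fin m) (Fin m) ℝ} {K : Matrix (Fin m) (Fin n) ℝ}
    (hterm : (S - (A + B * K)ᵀ * S * (A + B * K) - Q - Kᵀ * R * K).PosSemidef)
    (x : Fin n → ℝ) :
    x ⬝ᵥ (Q *ᵥ x) + (K *ᵥ x) ⬝ᵥ (R *ᵥ (K *ᵥ x)) +
        (A *ᵥ x + B *ᵥ (K *ᵥ x)) ⬝ᵥ (S *ᵥ (A *ᵥ x + B *ᵥ (K *ᵥ x))) ≤
      x ⬝ᵥ (S *ᵥ x) := by
  have conj : ∀ {k : ℕ} (M : Matrix (Fin k) (Fin n) ℝ) (P : Matrix (Fin k) (Fin k) ℝ),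
      x ⬝ᵥ ((Mᵀ * P * M) *ᵥ x) = (M *ᵥ x) ⬝ᵥ (P *ᵥ (M *ᵥ x)) := fun M P => by
    rw [← mulVec_mulVec, ← mulVec_mulVec, dotProduct_mulVec, vecMul_transpose]
  have h := hterm.dotProduct_mulVec_nonneg x
  rw [star_trivial, sub_mulVec, sub_mulVec, sub_mulVec, dotProduct_sub, dotProduct_sub,
    dotProduct_sub, conj, conj, add_mulVec, ← mulVec_mulVec] at h
  linarith

/-- Trajectories driven by the shifted input from `x₁` follow the original one. -/
theorem lqrTraj_shift {n m : ℕ} (A : Matrix (Fin n) (Fin n) ℝ)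
    (B : Matrix (Fin n) (Fin m) ℝ) (x0 : Fin n → ℝ) (u u' : ℕ → Fin m → ℝ) (j : ℕ)
    (h : ∀ i < j, u' i = u (i + 1)) :
    lqrTraj A B (lqrTraj A B x0 u 1) u' j = lqrTraj A B x0 u (j + 1) := by
  induction j with
  | zero => rfl
  | succ j ih =>
    rw [lqrTraj, ih fun i hi => h i (by omega), h j j.lt_succ_self,
      lqrTraj.eq_2 A B x0 u (j + 1)]

/-- Lemma 4 of the paper: under the terminal decrease condition, the shifted input sequence
`(u₁, …, u_{N−1}, K x_N)` applied from `x₁` decreases the cost by at least `x₀ᵀ Q x₀ ≥ α₃‖x₀‖²`,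
where `α₃` is the smallest eigenvalue of `Q`. -/
theorem shifted_sequence_cost_decrease {n m : ℕ}
    (A : Matrix (Fin n) (Fin n) ℝ) (B : Matrix (Fin n) (Fin m) ℝ)
    (Q S : Matrix (Fin n) (Fin n) ℝ) (R : Matrix (Fin m) (Fin m) ℝ)
    (hQ : Q.PosSemidef) (hS : S.PosSemidef) (hR : R.PosDef)
    (N : ℕ) (hN : 1 ≤ N) (K : Matrix (Fin m) (Fin n) ℝ)
    (hterm : (S - (A + B * K)ᵀ * S * (A + B * K) - Q - Kᵀ * R * K).PosSemidef)
    (α₃ : ℝ) (hα₃ : IsLeast (Set.range hQ.isHermitian.eigenvalues) α₃)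
    (x0 : Fin n → ℝ) (u u' : ℕ → Fin m → ℝ)
    (hu'₁ : ∀ j, j + 1 < N → u' j = u (j + 1))
    (hu'₂ : u' (N - 1) = K *ᵥ lqrTraj A B x0 u N) :
    lqrCost A B Q S R N (lqrTraj A B x0 u 1) u' ≤
        lqrCost A B Q S R N x0 u - x0 ⬝ᵥ (Q *ᵥ x0) ∧
    lqrCost A B Q S R N x0 u - x0 ⬝ᵥ (Q *ᵥ x0) ≤
        lqrCost A B Q S R N x0 u - α₃ * (x0 ⬝ᵥ x0) := by
  have lower := hQ.isHermitian.mul_dotProduct_le (fun i => hα₃.2 (Set.mem_range_self i)) x0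
  refine ⟨?_, sub_le_sub_left lower _⟩
  obtain ⟨N, rfl⟩ := Nat.exists_eq_add_of_le' hN
  rw [Nat.add_sub_cancel] at hu'₂
  have traj : ∀ j ≤ N,
      lqrTraj A B (lqrTraj A B x0 u 1) u' j = lqrTraj A B x0 u (j + 1) := fun j hj =>
    lqrTraj_shift A B x0 u u' j fun i hi => hu'₁ i (by omega)
  have sum_eq : ∑ j ∈ Finset.range N,
      (lqrTraj A B (lqrTraj A B x0 u 1) u' j ⬝ᵥ
        (Q *ᵥ lqrTraj A B (lqrTraj A B x0 u 1) u' j) + u' j ⬝ᵥ (R *ᵥ u' j)) =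
      ∑ j ∈ Finset.range N, (lqrTraj A B x0 u (j + 1) ⬝ᵥ (Q *ᵥ lqrTraj A B x0 u (j + 1)) +
        u (j + 1) ⬝ᵥ (R *ᵥ u (j + 1))) := by
    refine Finset.sum_congr rfl fun j hj => ?_
    have hj := Finset.mem_range.mp hj
    rw [traj j hj.le, hu'₁ j (by omega)]
  have input_nonneg : 0 ≤ u 0 ⬝ᵥ (R *ᵥ u 0) := by
    simpa using hR.posSemidef.dotProduct_mulVec_nonneg (u 0)
  have decrease := terminal_cost_decrease hterm (lqrTraj A B x0 u (N + 1))
  have last : lqrTraj A B (lqrTraj A B x0 u 1) u' (N + 1) =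
      A *ᵥ lqrTraj A B x0 u (N + 1) + B *ᵥ (K *ᵥ lqrTraj A B x0 u (N + 1)) := by
    rw [lqrTraj.eq_2, traj N le_rfl, hu'₂]
  have first : lqrTraj A B x0 u 0 = x0 := rfl
  rw [lqrCost, lqrCost, Finset.sum_range_succ, Finset.sum_range_succ', sum_eq, last,
    traj N le_rfl, hu'₂, first]
  linarith
end
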